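/- Janet division is not monotone for the degree-lexicographical ordering: for the set U = {xz², x²z, yzt²} in variables x ≻ y ≻ z ≻ t, U is complete up to w = x²yz with respect to degree-lexicographical order, the lowest irreducible nonmultiplicative prolongation is xyzt² which is degree-lexicographically greater than w, yet after adjoining xyzt² the set U ∪ {xyzt²} has the irreducible nonmultiplicative prolongation xyz² which is degree-lexicographically smaller than w; hence completeness up to w fails after the enlargement. -/

import Mathlib

/-- `w` is a monomial in the variables satisfying `S`. -/
def InMon {n : ℕ} (S : Fin n → Prop) (w : Fin n → ℕ) : Prop :=
  ∀ i, w i ≠ 0 → S i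

/-- `w ∈ u·⟨S⟩`: `w = u * t` with `t` a monomial in variables satisfying `S`. -/
def InCone {n : ℕ} (S : Fin n → Prop) (u w : Fin n → ℕ) : Prop :=
  ∃ t, InMon S t ∧ w = u + t

/-- Janet division (variables ordered `x ≻ y ≻ z ≻ t`, i.e. indices `0..3`). -/
def JanetMult {n : ℕ} (U : Finset (Fin n → ℕ)) (u : Fin n → ℕ) (i : Fin n) : Prop :=
  ∀ v ∈ U, (∀ j, j < i → v j = u j) → v i ≤ u i

/-- Degree-lexicographical ordering with `x 0 ≻ x 1 ≻ ⋯`. -/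
def DegLexLt {n : ℕ} (u v : Fin n → ℕ) : Prop :=
  (∑ i, u i) < (∑ i, v i) ∨
    ((∑ i, u i) = (∑ i, v i) ∧ ∃ i : Fin n, (∀ j, j < i → u j = v j) ∧ u i < v i)

/-- `m` has a Janet involutive divisor in `U`. -/
def HasJanetDiv {n : ℕ} (U : Finset (Fin n → ℕ)) (m : Fin n → ℕ) : Prop :=
  ∃ t ∈ U, InCone (JanetMult U t) t m

/-- `U` is complete up to `w` w.r.t. degree-lexicographical ordering. -/
def JanetCompleteDL {n : ℕ} (U : Finset (Fin n → ℕ)) (w : Fin n → ℕ) : Prop :=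
  ∀ u ∈ U, ∀ i : Fin n, ¬ JanetMult U u i →
    (DegLexLt (u + Pi.single i 1) w ∨ u + Pi.single i 1 = w) →
    HasJanetDiv U (u + Pi.single i 1)

theorem inCone_iff {n : ℕ} (S : Fin n → Prop) (u w : Fin n → ℕ) :
    InCone S u w ↔ ∀ i, u i ≤ w i ∧ (u i < w i → S i) := by
  constructor
  · rintro ⟨t, ht, rfl⟩ i
    refine ⟨Nat.le_add_right _ _, fun h => ht i ?_⟩
    rintro h0
    simp [h0] at h
  · intro h
    refine ⟨w - u, fun i hi => (h i).2 (Nat.sub_ne_zero_iff_lt.mp hi), ?_⟩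
    funext i
    exact (Nat.add_sub_cancel' (h i).1).symm

instance {n : ℕ} (U : Finset (Fin n → ℕ)) (u : Fin n → ℕ) : DecidablePred (JanetMult U u) :=
  fun i => inferInstanceAs (Decidable (∀ v ∈ U, (∀ j, j < i → v j = u j) → v i ≤ u i))

instance {n : ℕ} (u v : Fin n → ℕ) : Decidable (DegLexLt u v) :=
  inferInstanceAs (Decidable ((∑ i, u i) < (∑ i, v i) ∨
    ((∑ i, u i) = (∑ i, v i) ∧ ∃ i : Fin n, (∀ j, j < i → u j = v j) ∧ u i < v i)))

instance {n : ℕ} (S : Fin n → Prop) [DecidablePred S] (u w : Fin n → ℕ) :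
    Decidable (InCone S u w) :=
  decidable_of_iff' _ (inCone_iff S u w)

instance {n : ℕ} (U : Finset (Fin n → ℕ)) (m : Fin n → ℕ) : Decidable (HasJanetDiv U m) :=
  inferInstanceAs (Decidable (∃ t ∈ U, InCone (JanetMult U t) t m))

instance {n : ℕ} (U : Finset (Fin n → ℕ)) (w : Fin n → ℕ) : Decidable (JanetCompleteDL U w) :=
  inferInstanceAs (Decidable (∀ u ∈ U, ∀ i : Fin n, ¬ JanetMult U u i →
    (DegLexLt (u + Pi.single i 1) w ∨ u + Pi.single i 1 = w) →
    HasJanetDiv U (u + Pi.single i 1)))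

/-- Janet division is not monotone for the degree-lexicographical ordering:
counterexample `U = {xz², x²z, yzt²}`, `w = x²yz`. -/
theorem janet_not_monotone_deglex :
    let xz2 : Fin 4 → ℕ := ![1, 0, 2, 0]
    let x2z : Fin 4 → ℕ := ![2, 0, 1, 0]
    let yzt2 : Fin 4 → ℕ := ![0, 1, 1, 2]
    let U : Finset (Fin 4 → ℕ) := {xz2, x2z, yzt2}
    let w : Fin 4 → ℕ := ![2, 1, 1, 0]
    let p : Fin 4 → ℕ := ![1, 1, 1, 2]   -- xyzt²
    let q : Fin 4 → ℕ := ![1, 1, 2, 0]   -- xyz²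
    -- U is complete up to w w.r.t. deglex
    JanetCompleteDL U w ∧
    -- xyzt² = yzt²·x is an irreducible nonmultiplicative prolongation, ⊐ w
    (¬ JanetMult U yzt2 0 ∧ yzt2 + Pi.single 0 1 = p ∧ ¬ HasJanetDiv U p ∧
      DegLexLt w p) ∧
    -- and it is the lowest irreducible nonmultiplicative prolongation
    (∀ u ∈ U, ∀ i : Fin 4, ¬ JanetMult U u i →
      ¬ HasJanetDiv U (u + Pi.single i 1) → ¬ DegLexLt (u + Pi.single i 1) p) ∧
    -- after adjoining p, the prolongation xyz² = xz²·y is irreducible and ⊏ w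
    (¬ JanetMult (insert p U) xz2 1 ∧ xz2 + Pi.single 1 1 = q ∧
      ¬ HasJanetDiv (insert p U) q ∧ DegLexLt q w) ∧
    -- hence completeness up to w fails after the enlargement
    ¬ JanetCompleteDL (insert p U) w := by
  intro xz2 x2z yzt2 U w p q
  refine ⟨?_, ⟨?_, ?_, ?_, ?_⟩, ?_, ⟨?_, ?_, ?_, ?_⟩, ?_⟩ <;> decide
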